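/- Let n ≥ 1, let Q = 2n + 2, and let α, γ ∈ ℝ. Then for every real-valued φ ∈ C_c^∞(ℝ^{2n+1} \ {0}), ∫_{ℝ^{2n+1}} ρ^α (|z|/ρ)^γ |∇_ℍ φ|² dz dt ≥ ((Q + α − 2)/2)² ∫_{ℝ^{2n+1}} ρ^{α−2} (|z|/ρ)^{γ+2} φ² dz dt. (Here |z|/ρ equals |∇_ℍ ρ|, so this is the weighted Hardy inequality with the extra weight |∇_ℍ ρ|^γ.) -/

import Mathlib

open MeasureTheory Real

noncomputable section

/-- The underlying space of the Heisenberg group ℍⁿ, identified with ℝ^{2n+1}: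
points `(x, y, t)` with `x y : Fin n → ℝ`, `t : ℝ`; write `z = (x, y)`. -/
abbrev Hspace (n : ℕ) : Type := (Fin n → ℝ) × (Fin n → ℝ) × ℝ

/-- The horizontal vector field `X_j f = ∂f/∂x_j + 2 y_j ∂f/∂t`. -/
def Xd (n : ℕ) (j : Fin n) (f : Hspace n → ℝ) (p : Hspace n) : ℝ :=
  fderiv ℝ f p (Pi.single j 1, 0, 0) + 2 * p.2.1 j * fderiv ℝ f p (0, 0, 1)

/-- The horizontal vector field `Y_j f = ∂f/∂y_j − 2 x_j ∂f/∂t`. -/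
def Yd (n : ℕ) (j : Fin n) (f : Hspace n → ℝ) (p : Hspace n) : ℝ :=
  fderiv ℝ f p (0, Pi.single j 1, 0) - 2 * p.1 j * fderiv ℝ f p (0, 0, 1)

/-- Squared length of the horizontal gradient: `|∇_ℍ f|² = Σ_j ((X_j f)² + (Y_j f)²)`. -/
def gradH2 (n : ℕ) (f : Hspace n → ℝ) (p : Hspace n) : ℝ :=
  ∑ j : Fin n, ((Xd n j f p) ^ 2 + (Yd n j f p) ^ 2)

/-- The Kohn sub-Laplacian `Δ_ℍ f = Σ_j (X_j(X_j f) + Y_j(Y_j f))`. -/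
def lapH (n : ℕ) (f : Hspace n → ℝ) (p : Hspace n) : ℝ :=
  ∑ j : Fin n, (Xd n j (Xd n j f) p + Yd n j (Yd n j f) p)

/-- `|z|² = |x|² + |y|²`. -/
def zSq (n : ℕ) (p : Hspace n) : ℝ := ∑ j : Fin n, ((p.1 j) ^ 2 + (p.2.1 j) ^ 2)

/-- The homogeneous norm `ρ(z, t) = (|z|⁴ + t²)^{1/4}`. -/
def rho (n : ℕ) (p : Hspace n) : ℝ := ((zSq n p) ^ 2 + p.2.2 ^ 2) ^ ((4 : ℝ)⁻¹)

open Filter Topology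

/-- `N = ρ⁴`. -/
def cN (n : ℕ) (p : Hspace n) : ℝ := (zSq n p) ^ 2 + p.2.2 ^ 2

/-- `r = |z|⁴ / ρ⁴`. -/
def cR (n : ℕ) (p : Hspace n) : ℝ := (zSq n p) ^ 2 / cN n p

/-- truncated weight. -/
def Vk (n : ℕ) (a b : ℝ) (k : ℕ) (p : Hspace n) : ℝ :=
  cN n p ^ a * (cR n p ^ b * smoothTransition (k * cR n p - 1))

/-- generator of dilations -/
def Ev (n : ℕ) (p : Hspace n) : Hspace n := (p.1, p.2.1, 2 * p.2.2)

/-- generator of rotations -/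
def Rv (n : ℕ) (p : Hspace n) : Hspace n := (p.2.1, -p.1, 0)

/-- the field `|∇ρ|⁻² ρ ∇ρ` -/
def Gv (n : ℕ) (p : Hspace n) : Hspace n := Ev n p + (p.2.2 / zSq n p) • Rv n p

lemma clm_expand (n : ℕ) (L : Hspace n →L[ℝ] ℝ) (p : Hspace n) :
    L p = ∑ j, (p.1 j * L (Pi.single j 1, 0, 0) + p.2.1 j * L (0, Pi.single j 1, 0))
      + p.2.2 * L (0, 0, 1) := by
  have h : p = ∑ j, (p.1 j • ((Pi.single j 1, 0, 0) : Hspace n)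
      + p.2.1 j • ((0, Pi.single j 1, 0) : Hspace n)) + p.2.2 • ((0, 0, 1) : Hspace n) := by
    refine Prod.ext ?_ (Prod.ext ?_ ?_)
    · ext i
      simp [Prod.fst_sum, Finset.sum_apply, Pi.single_apply]
    · ext i
      simp [Prod.fst_sum, Prod.snd_sum, Finset.sum_apply, Pi.single_apply]
    · simp [Prod.snd_sum]
  conv_lhs => rw [h]
  rw [map_add, map_sum]
  simp only [map_add, map_smul, smul_eq_mul]

lemma zSq_nonneg (n : ℕ) (p : Hspace n) : 0 ≤ zSq n p :=
  Finset.sum_nonneg fun j _ => by positivity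

lemma zSq_eq_zero (n : ℕ) (p : Hspace n) (h : zSq n p = 0) : p.1 = 0 ∧ p.2.1 = 0 := by
  unfold zSq at h
  rw [Finset.sum_eq_zero_iff_of_nonneg (fun j _ => by positivity)] at h
  constructor
  · ext j
    have := h j (Finset.mem_univ j)
    simp only [Pi.zero_apply]
    nlinarith [sq_nonneg (p.1 j), sq_nonneg (p.2.1 j)]
  · ext j
    have := h j (Finset.mem_univ j)
    simp only [Pi.zero_apply]
    nlinarith [sq_nonneg (p.1 j), sq_nonneg (p.2.1 j)]

lemma zSq_contDiff (n : ℕ) : ContDiff ℝ 1 (zSq n) := by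
  unfold zSq
  fun_prop

lemma cN_contDiff (n : ℕ) : ContDiff ℝ 1 (cN n) := by
  unfold cN
  have := zSq_contDiff n
  fun_prop

lemma cN_pos (n : ℕ) (p : Hspace n) (h : zSq n p ≠ 0) : 0 < cN n p := by
  unfold cN; positivity

lemma cR_nonneg (n : ℕ) (p : Hspace n) : 0 ≤ cR n p := by
  unfold cR cN; positivity

lemma cR_pos (n : ℕ) (p : Hspace n) (h : zSq n p ≠ 0) : 0 < cR n p := by
  have := cN_pos n p h
  unfold cR; positivity

lemma cR_contDiffAt (n : ℕ) (p : Hspace n) (h : cN n p ≠ 0) : ContDiffAt ℝ 1 (cR n) p := by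
  unfold cR
  exact ((zSq_contDiff n).pow 2).contDiffAt.div (cN_contDiff n).contDiffAt h

lemma Vk_contDiffAt (n : ℕ) (a b : ℝ) (k : ℕ) (p : Hspace n) (h : zSq n p ≠ 0) :
    ContDiffAt ℝ 1 (Vk n a b k) p := by
  have hN := (cN_pos n p h).ne'
  have hR := (cR_pos n p h).ne'
  have h1 := cR_contDiffAt n p hN
  unfold Vk
  refine ((cN_contDiff n).contDiffAt.rpow_const_of_ne hN).mul
    ((h1.rpow_const_of_ne hR).mul ?_)
  exact (smoothTransition.contDiff (n := 1)).contDiffAt.comp p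
    ((contDiffAt_const.mul h1).sub contDiffAt_const)

lemma Vk_nonneg (n : ℕ) (a b : ℝ) (k : ℕ) (p : Hspace n) : 0 ≤ Vk n a b k p := by
  have h1 : 0 ≤ cN n p := by unfold cN; positivity
  have h2 := cR_nonneg n p
  have := smoothTransition.nonneg (k * cR n p - 1)
  unfold Vk; positivity

/-- near the axis, either `φ` or the weight vanishes -/
lemma near_axis (n : ℕ) (a b : ℝ) (k : ℕ) (φ : Hspace n → ℝ) (h0 : (0 : Hspace n) ∉ tsupport φ)
    (p : Hspace n) (h : zSq n p = 0) : (φ =ᶠ[𝓝 p] 0) ∨ (Vk n a b k =ᶠ[𝓝 p] 0) := by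
  obtain ⟨hx, hy⟩ := zSq_eq_zero n p h
  by_cases ht : p.2.2 = 0
  · left
    have : p = 0 := Prod.ext hx (Prod.ext hy ht)
    rw [this]
    exact notMem_tsupport_iff_eventuallyEq.1 h0
  · right
    have hN : cN n p ≠ 0 := by unfold cN; positivity
    have hc := (cR_contDiffAt n p hN).continuousAt
    have hc' : ContinuousAt (fun q => (k : ℝ) * cR n q - 1) p := by fun_prop
    have hlt : (k : ℝ) * cR n p - 1 < 0 := by simp [cR, h]
    filter_upwards [hc'.eventually_lt continuousAt_const hlt] with q hq
    simp [Vk, smoothTransition.zero_of_nonpos hq.le]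

lemma zSq_line (n : ℕ) (p v : Hspace n) :
    HasDerivAt (fun τ : ℝ => zSq n (p + τ • v))
      (∑ j, (2 * p.1 j * v.1 j + 2 * p.2.1 j * v.2.1 j)) 0 := by
  unfold zSq
  apply HasDerivAt.fun_sum
  intro j _
  have hx : HasDerivAt (fun τ : ℝ => (p + τ • v).1 j) (v.1 j) 0 := by
    simpa using ((hasDerivAt_id (0 : ℝ)).mul_const (v.1 j)).const_add (p.1 j)
  have hy : HasDerivAt (fun τ : ℝ => (p + τ • v).2.1 j) (v.2.1 j) 0 := by
    simpa using ((hasDerivAt_id (0 : ℝ)).mul_const (v.2.1 j)).const_add (p.2.1 j)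
  refine ((hx.pow 2).add (hy.pow 2)).congr_deriv ?_
  simp

lemma t_line (n : ℕ) (p v : Hspace n) :
    HasDerivAt (fun τ : ℝ => (p + τ • v).2.2) (v.2.2) 0 := by
  simpa using ((hasDerivAt_id (0 : ℝ)).mul_const (v.2.2)).const_add (p.2.2)

lemma zSq_Gv (n : ℕ) (p : Hspace n) :
    HasDerivAt (fun τ : ℝ => zSq n (p + τ • Gv n p)) (2 * zSq n p) 0 := by
  convert zSq_line n p (Gv n p) using 1
  unfold zSq
  rw [Finset.mul_sum]
  refine Finset.sum_congr rfl fun j _ => ?_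
  simp [Gv, Ev, Rv]
  ring

lemma zSq_Rv (n : ℕ) (p : Hspace n) :
    HasDerivAt (fun τ : ℝ => zSq n (p + τ • Rv n p)) 0 0 := by
  convert zSq_line n p (Rv n p) using 1
  symm
  refine Finset.sum_eq_zero fun j _ => ?_
  simp [Rv]
  ring

lemma fderiv_of_line (n : ℕ) (f : Hspace n → ℝ) (p v : Hspace n) (d : ℝ)
    (hf : DifferentiableAt ℝ f p) (h : HasDerivAt (fun τ : ℝ => f (p + τ • v)) d 0) :
    fderiv ℝ f p v = d := by
  have h1 : HasLineDerivAt ℝ f (fderiv ℝ f p v) p v := hf.hasFDerivAt.hasLineDerivAt v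
  exact HasDerivAt.unique h1 h

lemma Vk_euler (n : ℕ) (a b : ℝ) (k : ℕ) (p : Hspace n) (h : zSq n p ≠ 0) :
    fderiv ℝ (Vk n a b k) p (Gv n p) = 4 * a * Vk n a b k p := by
  have hN := (cN_pos n p h)
  have hR := (cR_pos n p h)
  apply fderiv_of_line
  · exact (Vk_contDiffAt n a b k p h).differentiableAt one_ne_zero
  have hs := zSq_Gv n p
  have ht : HasDerivAt (fun τ : ℝ => (p + τ • Gv n p).2.2) (2 * p.2.2) 0 := by
    simpa [Gv, Ev, Rv] using t_line n p (Gv n p)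
  have hNd : HasDerivAt (fun τ : ℝ => cN n (p + τ • Gv n p)) (4 * cN n p) 0 := by
    unfold cN
    refine ((hs.pow 2).add (ht.pow 2)).congr_deriv ?_
    simp
    ring
  have hRd : HasDerivAt (fun τ : ℝ => cR n (p + τ • Gv n p)) 0 0 := by
    unfold cR
    refine ((hs.pow 2).div hNd (by simpa using hN.ne')).congr_deriv ?_
    simp
    left
    ring
  have h1 : HasDerivAt (fun τ : ℝ => cN n (p + τ • Gv n p) ^ a) (4 * a * cN n p ^ a) 0 := by
    convert hNd.rpow_const (p := a) (Or.inl (by simpa using hN.ne')) using 1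
    simp only [zero_smul, add_zero]
    rw [Real.rpow_sub_one hN.ne']
    field_simp
  have h2 : HasDerivAt (fun τ : ℝ => cR n (p + τ • Gv n p) ^ b) 0 0 := by
    convert hRd.rpow_const (p := b) (Or.inl (by simpa using hR.ne')) using 1
    simp
  have h3 : HasDerivAt (fun τ : ℝ => smoothTransition (k * cR n (p + τ • Gv n p) - 1)) 0 0 := by
    have hd := ((smoothTransition.contDiff (n := 1)).differentiable (by simp)
      (k * cR n (p + (0 : ℝ) • Gv n p) - 1)).hasDerivAt
    have := hd.comp (0 : ℝ) ((hRd.const_mul (k : ℝ)).sub_const 1)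
    simpa [Function.comp_def] using this
  unfold Vk
  refine (h1.mul (h2.mul h3)).congr_deriv ?_
  simp
  ring

instance haar_H (n : ℕ) : (volume : Measure (Hspace n)).IsAddHaarMeasure := by
  have : (volume : Measure ((Fin n → ℝ) × ℝ)).IsAddHaarMeasure :=
    inferInstanceAs ((volume : Measure (Fin n → ℝ)).prod (volume : Measure ℝ)).IsAddHaarMeasure
  exact Measure.prod.instIsAddHaarMeasure (volume : Measure (Fin n → ℝ))
    (volume : Measure ((Fin n → ℝ) × ℝ))

lemma ibp (n : ℕ) (F : Hspace n → ℝ) (hF : ContDiff ℝ 1 F) (hc : HasCompactSupport F)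
    (l : Hspace n →L[ℝ] ℝ) (v : Hspace n) :
    Integrable (fun p => l p * fderiv ℝ F p v) ∧
    ∫ p, l p * fderiv ℝ F p v = - (l v * ∫ p, F p) := by
  have hFd : Continuous (fun p => fderiv ℝ F p v) :=
    (hF.continuous_fderiv one_ne_zero).clm_apply continuous_const
  have i1 : Integrable (fun p => l p * fderiv ℝ F p v) :=
    (l.continuous.mul hFd).integrable_of_hasCompactSupport ((hc.fderiv_apply ℝ v).mul_left)
  refine ⟨i1, ?_⟩
  rw [integral_mul_fderiv_eq_neg_fderiv_mul_of_integrable]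
  · simp [integral_const_mul]
  · simpa using (hF.continuous.integrable_of_hasCompactSupport hc).const_mul (l v)
  · exact i1
  · exact (l.continuous.mul hF.continuous).integrable_of_hasCompactSupport hc.mul_left
  · exact fun x _ => l.differentiableAt
  · exact fun x _ => hF.differentiable one_ne_zero x

/-- coordinate functionals -/
def lx (n : ℕ) (j : Fin n) : Hspace n →L[ℝ] ℝ :=
  (ContinuousLinearMap.proj j).comp (ContinuousLinearMap.fst ℝ _ _)
/-- coordinate functionals -/
def ly (n : ℕ) (j : Fin n) : Hspace n →L[ℝ] ℝ :=
  (ContinuousLinearMap.proj j).comp ((ContinuousLinearMap.fst ℝ _ _).comp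
    (ContinuousLinearMap.snd ℝ _ _))
/-- coordinate functionals -/
def lt (n : ℕ) : Hspace n →L[ℝ] ℝ :=
  (ContinuousLinearMap.snd ℝ _ _).comp (ContinuousLinearMap.snd ℝ _ _)

lemma int_Ev (n : ℕ) (F : Hspace n → ℝ) (hF : ContDiff ℝ 1 F) (hc : HasCompactSupport F) :
    Integrable (fun p => fderiv ℝ F p (Ev n p)) ∧
    ∫ p, fderiv ℝ F p (Ev n p) = - ((2 * n + 2) * ∫ p, F p) := by
  have hx := fun j => ibp n F hF hc (lx n j) (Pi.single j 1, 0, 0)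
  have hy := fun j => ibp n F hF hc (ly n j) (0, Pi.single j 1, 0)
  have ht := ibp n F hF hc ((2 : ℝ) • lt n) (0, 0, 1)
  have e : (fun p => fderiv ℝ F p (Ev n p)) = fun p =>
      ∑ j, (lx n j p * fderiv ℝ F p (Pi.single j 1, 0, 0)
        + ly n j p * fderiv ℝ F p (0, Pi.single j 1, 0))
      + ((2 : ℝ) • lt n) p * fderiv ℝ F p (0, 0, 1) := by
    ext p
    rw [clm_expand n _ (Ev n p)]
    simp [Ev, lx, ly, lt]
  have hi : ∀ j ∈ Finset.univ, Integrable (fun p =>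
      (lx n j p * fderiv ℝ F p (Pi.single j 1, 0, 0)
        + ly n j p * fderiv ℝ F p (0, Pi.single j 1, 0))) :=
    fun j _ => (hx j).1.add (hy j).1
  rw [e]
  refine ⟨(integrable_finsetSum _ hi).add ht.1, ?_⟩
  rw [integral_add (integrable_finsetSum _ hi) ht.1, integral_finsetSum _ hi, ht.2]
  simp_rw [fun j => integral_add (hx j).1 (hy j).1, (hx _).2, (hy _).2]
  simp [lx, ly, lt]
  ring

lemma int_Rv (n : ℕ) (F : Hspace n → ℝ) (hF : ContDiff ℝ 1 F) (hc : HasCompactSupport F) :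
    Integrable (fun p => fderiv ℝ F p (Rv n p)) ∧
    ∫ p, fderiv ℝ F p (Rv n p) = 0 := by
  have hx := fun j => ibp n F hF hc (ly n j) (Pi.single j 1, 0, 0)
  have hy := fun j => ibp n F hF hc (-lx n j) (0, Pi.single j 1, 0)
  have e : (fun p => fderiv ℝ F p (Rv n p)) = fun p =>
      ∑ j, (ly n j p * fderiv ℝ F p (Pi.single j 1, 0, 0)
        + (-lx n j) p * fderiv ℝ F p (0, Pi.single j 1, 0)) := by
    ext p
    rw [clm_expand n _ (Rv n p)]
    simp [Rv, lx, ly]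
  have hi : ∀ j ∈ Finset.univ, Integrable (fun p =>
      (ly n j p * fderiv ℝ F p (Pi.single j 1, 0, 0)
        + (-lx n j) p * fderiv ℝ F p (0, Pi.single j 1, 0))) :=
    fun j _ => (hx j).1.add (hy j).1
  rw [e]
  refine ⟨(integrable_finsetSum _ hi), ?_⟩
  rw [integral_finsetSum _ hi]
  simp_rw [fun j => integral_add (hx j).1 (hy j).1, (hx _).2, (hy _).2]
  simp [lx, ly]

/-- divergence theorem for `G` -/
lemma int_Gv (n : ℕ) (F : Hspace n → ℝ) (hF : ContDiff ℝ 1 F) (hc : HasCompactSupport F)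
    (hz : ∀ p, zSq n p = 0 → F =ᶠ[𝓝 p] 0) :
    Integrable (fun p => fderiv ℝ F p (Gv n p)) ∧
    ∫ p, fderiv ℝ F p (Gv n p) = - ((2 * n + 2) * ∫ p, F p) := by
  let K : Hspace n → ℝ := fun p => p.2.2 / zSq n p * F p
  have hKz : ∀ p, zSq n p = 0 → K =ᶠ[𝓝 p] 0 := by
    intro p h
    filter_upwards [hz p h] with q hq
    simp [K, hq]
  have hcd : ∀ p, zSq n p ≠ 0 → ContDiffAt ℝ 1 (fun p : Hspace n => p.2.2 / zSq n p) p := by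
    intro p h
    exact ContDiffAt.div (by fun_prop) (zSq_contDiff n).contDiffAt h
  have hK : ContDiff ℝ 1 K := by
    rw [contDiff_iff_contDiffAt]
    intro p
    by_cases h : zSq n p = 0
    · exact contDiffAt_const.congr_of_eventuallyEq (hKz p h)
    · exact (hcd p h).mul hF.contDiffAt
  have hKc : HasCompactSupport K := hc.mul_left
  have e : (fun p => fderiv ℝ F p (Gv n p)) =
      fun p => fderiv ℝ F p (Ev n p) + fderiv ℝ K p (Rv n p) := by
    ext p
    by_cases h : zSq n p = 0
    · rw [(hz p h).fderiv_eq, (hKz p h).fderiv_eq]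
      simp
    · have hd := (hcd p h).differentiableAt one_ne_zero
      have h0 : fderiv ℝ (fun p : Hspace n => p.2.2 / zSq n p) p (Rv n p) = 0 := by
        apply fderiv_of_line _ _ _ _ _ hd
        have ht : HasDerivAt (fun τ : ℝ => (p + τ • Rv n p).2.2) 0 0 := by
          simpa [Rv] using t_line n p (Rv n p)
        refine (ht.div (zSq_Rv n p) (by simpa using h)).congr_deriv ?_
        simp
      have hm : fderiv ℝ K p = _ := fderiv_fun_mul hd (hF.differentiable one_ne_zero p)
      rw [hm]
      simp [h0, Gv]
  have hE := int_Ev n F hF hc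
  have hR := int_Rv n K hK hKc
  rw [e]
  refine ⟨hE.1.add hR.1, ?_⟩
  rw [integral_add hE.1 hR.1, hE.2, hR.2, add_zero]

/-- truncated Hardy inequality -/
lemma hardy_trunc (n : ℕ) (a b : ℝ) (k : ℕ) (φ : Hspace n → ℝ) (hφ : ContDiff ℝ (⊤ : ℕ∞) φ)
    (hcs : HasCompactSupport φ) (h0 : (0 : Hspace n) ∉ tsupport φ) :
    Continuous (fun p => Vk n a b k p * φ p ^ 2) ∧
    Integrable (fun p => Vk n a b k p * φ p ^ 2) ∧
    Integrable (fun p => Vk n a b k p * (fderiv ℝ φ p (Gv n p)) ^ 2) ∧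
    ((2 * n + 2 + 4 * a) / 2) ^ 2 * ∫ p, Vk n a b k p * φ p ^ 2 ≤
      ∫ p, Vk n a b k p * (fderiv ℝ φ p (Gv n p)) ^ 2 := by
  have hφ1 : ContDiff ℝ 1 φ := hφ.of_le (by exact_mod_cast le_top)
  have hφd : Continuous (fderiv ℝ φ) := hφ1.continuous_fderiv one_ne_zero
  have hnear : ∀ p, zSq n p = 0 → (∀ᶠ q in 𝓝 p, Vk n a b k q = 0 ∨ (φ q = 0 ∧ fderiv ℝ φ q = 0)) := by
    intro p h
    rcases near_axis n a b k φ h0 p h with h1 | h1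
    · have h2 : fderiv ℝ φ =ᶠ[𝓝 p] fderiv ℝ (0 : Hspace n → ℝ) := h1.fderiv
      filter_upwards [h1, h2] with q hq hq'
      right
      refine ⟨hq, ?_⟩
      rw [hq']; simp
    · filter_upwards [h1] with q hq
      exact Or.inl hq
  have hGc : ∀ p, zSq n p ≠ 0 → ContinuousAt (fun p => fderiv ℝ φ p (Gv n p)) p := by
    intro p h
    have hg : ContinuousAt (Gv n) p := by
      have h1 : ContinuousAt (zSq n) p := (zSq_contDiff n).continuous.continuousAt
      have h2 : ContinuousAt (fun p : Hspace n => p.2.2 / zSq n p) p :=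
        ContinuousAt.div (by fun_prop) h1 h
      have h3 : Continuous (Ev n) := by unfold Ev; fun_prop
      have h4 : Continuous (Rv n) := by unfold Rv; fun_prop
      exact h3.continuousAt.add (h2.smul h4.continuousAt)
    exact hφd.continuousAt.clm_apply hg
  have hFz : ∀ p, zSq n p = 0 → (fun p => Vk n a b k p * φ p ^ 2) =ᶠ[𝓝 p] 0 := by
    intro p h
    filter_upwards [hnear p h] with q hq
    rcases hq with hq | hq <;> simp [hq]
  have hF : ContDiff ℝ 1 (fun p => Vk n a b k p * φ p ^ 2) := by
    rw [contDiff_iff_contDiffAt]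
    intro p
    by_cases h : zSq n p = 0
    · exact contDiffAt_const.congr_of_eventuallyEq (hFz p h)
    · exact (Vk_contDiffAt n a b k p h).mul (hφ1.pow 2).contDiffAt
  have hP : Continuous (fun p => Vk n a b k p * (fderiv ℝ φ p (Gv n p)) ^ 2) := by
    rw [continuous_iff_continuousAt]
    intro p
    by_cases h : zSq n p = 0
    · refine (continuousAt_const (y := (0 : ℝ))).congr_of_eventuallyEq ?_
      filter_upwards [hnear p h] with q hq
      rcases hq with hq | hq <;> simp [hq]
    · exact (Vk_contDiffAt n a b k p h).continuousAt.mul ((hGc p h).pow 2)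
  have hM : Continuous (fun p => Vk n a b k p * (φ p * fderiv ℝ φ p (Gv n p))) := by
    rw [continuous_iff_continuousAt]
    intro p
    by_cases h : zSq n p = 0
    · refine (continuousAt_const (y := (0 : ℝ))).congr_of_eventuallyEq ?_
      filter_upwards [hnear p h] with q hq
      rcases hq with hq | hq <;> simp [hq]
    · exact (Vk_contDiffAt n a b k p h).continuousAt.mul
        (hφ1.continuous.continuousAt.mul (hGc p h))
  have hout : ∀ p, p ∉ tsupport φ → φ p = 0 ∧ fderiv ℝ φ p = 0 := fun p hp =>
    ⟨image_eq_zero_of_notMem_tsupport hp, fderiv_of_notMem_tsupport ℝ hp⟩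
  have hFc : HasCompactSupport (fun p => Vk n a b k p * φ p ^ 2) :=
    HasCompactSupport.intro hcs fun p hp => by simp [hout p hp]
  have hPc : HasCompactSupport (fun p => Vk n a b k p * (fderiv ℝ φ p (Gv n p)) ^ 2) :=
    HasCompactSupport.intro hcs fun p hp => by simp [hout p hp]
  have hMc : HasCompactSupport (fun p => Vk n a b k p * (φ p * fderiv ℝ φ p (Gv n p))) :=
    HasCompactSupport.intro hcs fun p hp => by simp [hout p hp]
  have iF := hF.continuous.integrable_of_hasCompactSupport (μ := volume) hFc
  have iP := hP.integrable_of_hasCompactSupport (μ := volume) hPc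
  have iM := hM.integrable_of_hasCompactSupport (μ := volume) hMc
  refine ⟨hF.continuous, iF, iP, ?_⟩
  have hdiv := (int_Gv n _ hF hFc hFz).2
  have e : (fun p => fderiv ℝ (fun p => Vk n a b k p * φ p ^ 2) p (Gv n p)) = fun p =>
      4 * a * (Vk n a b k p * φ p ^ 2) + 2 * (Vk n a b k p * (φ p * fderiv ℝ φ p (Gv n p))) := by
    ext p
    by_cases h : zSq n p = 0
    · rw [(hFz p h).fderiv_eq]
      rcases (hnear p h).self_of_nhds with hq | hq <;> simp [hq]
    · have hφp := hφ1.differentiable one_ne_zero p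
      rw [fderiv_fun_mul ((Vk_contDiffAt n a b k p h).differentiableAt one_ne_zero)
        (hφp.fun_pow 2)]
      rw [fderiv_fun_pow 2 hφp]
      simp [Vk_euler n a b k p h]
      ring
  rw [e, integral_add (iF.const_mul _) (iM.const_mul _), integral_const_mul,
    integral_const_mul] at hdiv
  have hpos : 0 ≤ ∫ p, Vk n a b k p *
      (fderiv ℝ φ p (Gv n p) + (2 * n + 2 + 4 * a) / 2 * φ p) ^ 2 :=
    integral_nonneg fun p => mul_nonneg (Vk_nonneg n a b k p) (sq_nonneg _)
  have e2 : (fun p => Vk n a b k p *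
      (fderiv ℝ φ p (Gv n p) + (2 * n + 2 + 4 * a) / 2 * φ p) ^ 2) = fun p =>
      Vk n a b k p * (fderiv ℝ φ p (Gv n p)) ^ 2 +
      ((2 * n + 2 + 4 * a) * (Vk n a b k p * (φ p * fderiv ℝ φ p (Gv n p))) +
      ((2 * n + 2 + 4 * a) / 2) ^ 2 * (Vk n a b k p * φ p ^ 2)) := by
    ext p; ring
  have i2 : Integrable (fun p =>
      (2 * n + 2 + 4 * a) * (Vk n a b k p * (φ p * fderiv ℝ φ p (Gv n p))) +
      ((2 * n + 2 + 4 * a) / 2) ^ 2 * (Vk n a b k p * φ p ^ 2)) :=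
    (iM.const_mul _).add (iF.const_mul _)
  rw [e2, integral_add iP i2,
    integral_add (iM.const_mul _) (iF.const_mul _), integral_const_mul,
    integral_const_mul] at hpos
  set A := ∫ p, Vk n a b k p * φ p ^ 2
  set B := ∫ p, Vk n a b k p * (φ p * fderiv ℝ φ p (Gv n p))
  have hB : B = -((2 * n + 2 + 4 * a) / 2) * A := by linarith
  rw [hB] at hpos
  nlinarith [hpos]

lemma cs_grad (n : ℕ) (φ : Hspace n → ℝ) (p : Hspace n) (h : zSq n p ≠ 0) :
    zSq n p * (fderiv ℝ φ p (Gv n p)) ^ 2 ≤ cN n p * gradH2 n φ p := by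
  have hs : 0 < zSq n p := lt_of_le_of_ne (zSq_nonneg n p) (Ne.symm h)
  set s := zSq n p with hsdef
  set t := p.2.2 with htdef
  -- coefficients
  let c : Fin n ⊕ Fin n → ℝ := Sum.elim (fun j => s * p.1 j + t * p.2.1 j)
    (fun j => s * p.2.1 j - t * p.1 j)
  let d : Fin n ⊕ Fin n → ℝ := Sum.elim (fun j => Xd n j φ p) (fun j => Yd n j φ p)
  have hcs := Finset.sum_mul_sq_le_sq_mul_sq Finset.univ c d
  have h1 : ∑ i, c i ^ 2 = cN n p * s := by
    rw [Fintype.sum_sum_type, ← Finset.sum_add_distrib]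
    have : cN n p * s = ∑ j, cN n p * ((p.1 j) ^ 2 + (p.2.1 j) ^ 2) := by
      rw [hsdef]; conv_lhs => rw [zSq, Finset.mul_sum]
    rw [this]
    refine Finset.sum_congr rfl fun j _ => ?_
    simp only [c, Sum.elim_inl, Sum.elim_inr, cN, ← hsdef, ← htdef]
    ring
  have h2 : ∑ i, d i ^ 2 = gradH2 n φ p := by
    rw [Fintype.sum_sum_type, ← Finset.sum_add_distrib]
    rfl
  have h3 : ∑ i, c i * d i = s * fderiv ℝ φ p (Gv n p) := by
    rw [Fintype.sum_sum_type, ← Finset.sum_add_distrib, clm_expand n _ (Gv n p), mul_add,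
      Finset.mul_sum]
    have : s * ((Gv n p).2.2 * fderiv ℝ φ p (0, 0, 1)) =
        ∑ j, 2 * t * fderiv ℝ φ p (0, 0, 1) * ((p.1 j) ^ 2 + (p.2.1 j) ^ 2) := by
      rw [← Finset.mul_sum]
      change _ = _ * zSq n p
      simp [Gv, Ev, Rv, ← hsdef, ← htdef]
      ring
    rw [this, ← Finset.sum_add_distrib]
    refine Finset.sum_congr rfl fun j _ => ?_
    simp [c, d, Xd, Yd, Gv, Ev, Rv, ← hsdef, ← htdef]
    field_simp
    ring
  rw [h1, h2, h3] at hcs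
  have : s * (s * (fderiv ℝ φ p (Gv n p)) ^ 2) ≤ s * (cN n p * gradH2 n φ p) := by
    linarith [hcs]
  exact le_of_mul_le_mul_left this hs

lemma rho_rpow (n : ℕ) (p : Hspace n) (α : ℝ) : rho n p ^ α = cN n p ^ (α / 4) := by
  have h1 : 0 ≤ cN n p := by unfold cN; positivity
  change (cN n p ^ ((4 : ℝ)⁻¹)) ^ α = _
  rw [← Real.rpow_mul h1]
  congr 1; ring

lemma ratio_rpow (n : ℕ) (p : Hspace n) (γ : ℝ) :
    (Real.sqrt (zSq n p) / rho n p) ^ γ = cR n p ^ (γ / 4) := by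
  have h1 : 0 ≤ cN n p := by unfold cN; positivity
  have hs := zSq_nonneg n p
  have : Real.sqrt (zSq n p) / rho n p = cR n p ^ ((4 : ℝ)⁻¹) := by
    change _ / cN n p ^ ((4 : ℝ)⁻¹) = _
    unfold cR
    rw [Real.div_rpow (by positivity) h1, ← Real.rpow_natCast, ← Real.rpow_mul hs,
      Real.sqrt_eq_rpow]
    norm_num
  rw [this, ← Real.rpow_mul (cR_nonneg n p)]
  congr 1; ring

lemma ae_axis (n : ℕ) (hn : 1 ≤ n) : ∀ᵐ p : Hspace n, zSq n p ≠ 0 := by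
  let j : Fin n := ⟨0, hn⟩
  have h := Measure.addHaar_submodule (volume : Measure (Hspace n))
    (LinearMap.ker (lx n j : Hspace n →ₗ[ℝ] ℝ)) (by
      intro h
      have : ((Pi.single j 1, 0, 0) : Hspace n) ∈ LinearMap.ker (lx n j : Hspace n →ₗ[ℝ] ℝ) := by
        rw [h]; trivial
      simp [lx] at this)
  rw [ae_iff]
  refine measure_mono_null ?_ h
  intro p hp
  have := (zSq_eq_zero n p (by simpa using hp)).1
  simp [lx, this]

lemma weight_le (n : ℕ) (α γ : ℝ) (k : ℕ) (φ : Hspace n → ℝ) (p : Hspace n) :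
    Vk n ((α - 2) / 4) ((γ + 2) / 4) k p * (fderiv ℝ φ p (Gv n p)) ^ 2 ≤
      rho n p ^ α * (Real.sqrt (zSq n p) / rho n p) ^ γ * gradH2 n φ p := by
  rw [rho_rpow, ratio_rpow]
  have hN0 : 0 ≤ cN n p := by unfold cN; positivity
  have hR0 := cR_nonneg n p
  have hg : 0 ≤ gradH2 n φ p := Finset.sum_nonneg fun j _ => by positivity
  by_cases h : zSq n p = 0
  · have : cR n p = 0 := by simp [cR, h]
    have hV : Vk n ((α - 2) / 4) ((γ + 2) / 4) k p = 0 := by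
      simp [Vk, this, smoothTransition.zero_of_nonpos (show (-1 : ℝ) ≤ 0 by norm_num)]
    rw [hV, zero_mul]
    positivity
  · have hN := cN_pos n p h
    have hR := cR_pos n p h
    have hs : 0 < zSq n p := lt_of_le_of_ne (zSq_nonneg n p) (Ne.symm h)
    have hc := cs_grad n φ p h
    set D := fderiv ℝ φ p (Gv n p)
    have e1 : cN n p ^ ((α - 2) / 4) * cR n p ^ ((γ + 2) / 4) =
        cN n p ^ (α / 4) * cR n p ^ (γ / 4) * (zSq n p / cN n p) := by
      have a1 : (α - 2) / 4 = α / 4 - 1 / 2 := by ring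
      have a2 : (γ + 2) / 4 = γ / 4 + 1 / 2 := by ring
      rw [a1, a2, Real.rpow_sub hN, Real.rpow_add hR, ← Real.sqrt_eq_rpow, ← Real.sqrt_eq_rpow]
      have : √(cR n p) = zSq n p / √(cN n p) := by
        rw [cR, Real.sqrt_div (by positivity), Real.sqrt_sq hs.le]
      rw [this]
      have hq : √(cN n p) ≠ 0 := (Real.sqrt_pos.2 hN).ne'
      have h5 := Real.sq_sqrt hN0
      field_simp
      rw [h5]
    have hV : Vk n ((α - 2) / 4) ((γ + 2) / 4) k p ≤
        cN n p ^ (α / 4) * cR n p ^ (γ / 4) * (zSq n p / cN n p) := by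
      rw [← e1, Vk, ← mul_assoc]
      exact mul_le_of_le_one_right (by positivity) (smoothTransition.le_one _)
    calc _ ≤ cN n p ^ (α / 4) * cR n p ^ (γ / 4) * (zSq n p / cN n p) * D ^ 2 := by gcongr
      _ = cN n p ^ (α / 4) * cR n p ^ (γ / 4) * ((zSq n p * D ^ 2) / cN n p) := by ring
      _ ≤ _ := by
        gcongr
        rw [div_le_iff₀ hN]
        linarith

/-- the weighted Hardy inequality on ℍⁿ with the extra weight
`|∇_ℍ ρ|^γ = (|z|/ρ)^γ`:
`∫ ρ^α (|z|/ρ)^γ |∇_ℍ φ|² ≥ ((Q + α − 2)/2)² ∫ ρ^{α−2} (|z|/ρ)^{γ+2} φ²`. -/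
theorem heisenberg_weighted_hardy_extra_weight (n : ℕ) (hn : 1 ≤ n) (Q α γ : ℝ)
    (hQ : Q = 2 * n + 2) (φ : Hspace n → ℝ) (hφ : ContDiff ℝ (⊤ : ℕ∞) φ)
    (hcs : HasCompactSupport φ) (h0 : (0 : Hspace n) ∉ tsupport φ) :
    (∫⁻ p, ENNReal.ofReal
        (rho n p ^ α * (Real.sqrt (zSq n p) / rho n p) ^ γ * gradH2 n φ p)) ≥
      ENNReal.ofReal (((Q + α - 2) / 2) ^ 2) *
        ∫⁻ p, ENNReal.ofReal
          (rho n p ^ (α - 2) * (Real.sqrt (zSq n p) / rho n p) ^ (γ + 2) * (φ p) ^ 2) := by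
  have hk : ∀ k : ℕ, ENNReal.ofReal (((Q + α - 2) / 2) ^ 2) *
        ∫⁻ p, ENNReal.ofReal (Vk n ((α - 2) / 4) ((γ + 2) / 4) k p * φ p ^ 2) ≤
      ∫⁻ p, ENNReal.ofReal
        (rho n p ^ α * (Real.sqrt (zSq n p) / rho n p) ^ γ * gradH2 n φ p) := by
    intro k
    obtain ⟨-, iF, iP, hle⟩ := hardy_trunc n ((α - 2) / 4) ((γ + 2) / 4) k φ hφ hcs h0
    rw [← ofReal_integral_eq_lintegral_ofReal iF
      (Eventually.of_forall fun p => mul_nonneg (Vk_nonneg _ _ _ _ _) (sq_nonneg _)),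
      ← ENNReal.ofReal_mul (sq_nonneg _)]
    have e : (Q + α - 2) / 2 = (2 * n + 2 + 4 * ((α - 2) / 4)) / 2 := by rw [hQ]; ring
    rw [e]
    refine (ENNReal.ofReal_le_ofReal hle).trans ?_
    rw [ofReal_integral_eq_lintegral_ofReal iP
      (Eventually.of_forall fun p => mul_nonneg (Vk_nonneg _ _ _ _ _) (sq_nonneg _))]
    exact lintegral_mono fun p => ENNReal.ofReal_le_ofReal (weight_le n α γ k φ p)
  have hlim : Tendsto (fun k : ℕ => ∫⁻ p, ENNReal.ofReal
      (Vk n ((α - 2) / 4) ((γ + 2) / 4) k p * φ p ^ 2)) atTop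
      (𝓝 (∫⁻ p, ENNReal.ofReal
          (rho n p ^ (α - 2) * (Real.sqrt (zSq n p) / rho n p) ^ (γ + 2) * (φ p) ^ 2))) := by
    apply lintegral_tendsto_of_tendsto_of_monotone
    · intro k
      exact (hardy_trunc n ((α - 2) / 4) ((γ + 2) / 4) k φ hφ hcs
        h0).1.measurable.ennreal_ofReal.aemeasurable
    · refine Eventually.of_forall fun p k l hkl => ENNReal.ofReal_le_ofReal ?_
      have h1 : 0 ≤ cN n p := by unfold cN; positivity
      have h2 := cR_nonneg n p
      have h3 : smoothTransition (k * cR n p - 1) ≤ smoothTransition (l * cR n p - 1) := by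
        apply smoothTransition.monotone
        have : (k : ℝ) ≤ l := by exact_mod_cast hkl
        gcongr
      unfold Vk
      gcongr
    · filter_upwards [ae_axis n hn] with p hp
      apply tendsto_const_nhds.congr'
      obtain ⟨K, hK⟩ := exists_nat_ge (2 / cR n p)
      have hR := cR_pos n p hp
      filter_upwards [eventually_ge_atTop K] with k hkK
      have h1 : (2 : ℝ) / cR n p ≤ k := hK.trans (by exact_mod_cast hkK)
      rw [div_le_iff₀ hR] at h1
      rw [rho_rpow, ratio_rpow, Vk, smoothTransition.one_of_one_le (by linarith), mul_one]
  exact le_of_tendsto' (ENNReal.Tendsto.const_mul hlim (Or.inr ENNReal.ofReal_ne_top)) hk
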